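/- In the setting of the conical boundary value problem, assume the stability condition P > xQ, fix β₀ ∈ (0,1], let k be a positive integer, k' > 0, h an integer, and set x = k/(k+k'), s_Σ = 2(1−h)/k, ŝ = 2x·s_Σ + 2, r̂ = N, α = N·(s_Σ·x² − 3β₀(x+1) + x + 3)/(2k₂²·x·(1 + (k₁ − k₂)²)). Let (d₀, d₁) be the unique pair of reals such that ψ(t₋) = ψ(t₊) = 0. Then d₁ = 0 if and only if (1 + k₁² + k₂²)(x − 1)(s_Σ·x² − 3β₀(x+1) + x + 3) = 2k₁k₂(−3β₀ + s_Σ·x³ − x²(β₀ + s_Σ − 1) + 3). -/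

import Mathlib

theorem aux_rpow (u v : ℝ) (hu : 0 ≤ u) (h : v = u ^ 2) : v ^ ((3 : ℝ) / 2) = u ^ 3 := by
  rw [h, ← Real.rpow_natCast u 2, ← Real.rpow_mul hu, ← Real.rpow_natCast u 3]
  norm_num

/-- A conical momentum-construction solution is twisted Kähler–Einstein exactly when
the linear coefficient `d₁` of its momentum function vanishes. -/
theorem twisted_KE_iff_linear_term_vanishes
    (k : ℕ) (hk : 0 < k) (k' : ℝ) (hk' : 0 < k') (h : ℤ)
    (x k1 k2 θ N P Q C tm tp : ℝ)
    (hxval : x = (k : ℝ) / ((k : ℝ) + k'))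
    (hx : x ∈ Set.Ioo (0 : ℝ) 1) (hk1 : k1 < 0) (hk2 : k2 ≠ 0)
    (hθ : θ ∈ Set.Ioo 0 Real.pi)
    (hN : N = Real.sqrt ((1 - k1 ^ 2 + k2 ^ 2) ^ 2 + 4 * k1 ^ 2))
    (hcos : Real.cos θ = (1 - k1 ^ 2 + k2 ^ 2) / N)
    (hsin : Real.sin θ = -(2 * k1) / N)
    (hP : P = 1 + (k1 + k2) ^ 2) (hQ : Q = 1 + (k1 - k2) ^ 2)
    (hC : C = 4 * k1 * k2 * (P - x ^ 2 * Q) / (x ^ 2 * N ^ 2))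
    (htm : tm = (1 - x) / x) (htp : tp = (1 + x) / x)
    (hstab : P > x * Q)
    (beta0 sS shat rhat alpha : ℝ)
    (hbeta0 : beta0 ∈ Set.Ioc (0 : ℝ) 1)
    (hsS : sS = 2 * (1 - (h : ℝ)) / (k : ℝ))
    (hshat : shat = 2 * x * sS + 2) (hrhat : rhat = N)
    (halpha : alpha = N * (sS * x ^ 2 - 3 * beta0 * (x + 1) + x + 3)
      / (2 * k2 ^ 2 * x * (1 + (k1 - k2) ^ 2)))
    (ψ : ℝ → ℝ → ℝ → ℝ)
    (hψ : ψ = fun d0 d1 t => sS * t ^ 2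
      + (alpha * Real.cos θ / (3 * Real.sin θ ^ 2) - (shat - alpha * rhat) / 6) * t ^ 3
      - (alpha / 3) * Real.sin θ * ((Real.cot θ ^ 2 + 1) * (t ^ 2 + C)) ^ ((3 : ℝ) / 2)
      + d0 + d1 * t)
    (d0 d1 : ℝ)
    (hbc0 : ψ d0 d1 tm = 0) (hbc1 : ψ d0 d1 tp = 0)
    (huniq : ∀ e0 e1 : ℝ, ψ e0 e1 tm = 0 → ψ e0 e1 tp = 0 → e0 = d0 ∧ e1 = d1) :
    d1 = 0 ↔
      (1 + k1 ^ 2 + k2 ^ 2) * (x - 1) * (sS * x ^ 2 - 3 * beta0 * (x + 1) + x + 3)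
        = 2 * k1 * k2 * (-3 * beta0 + sS * x ^ 3 - x ^ 2 * (beta0 + sS - 1) + 3) := by
  obtain ⟨hx0, hx1⟩ := hx
  have hx' : x ≠ 0 := hx0.ne'
  have hk1' : k1 ≠ 0 := hk1.ne
  have hPpos : 0 < P := by rw [hP]; positivity
  have hQpos : 0 < Q := by rw [hQ]; positivity
  have hN2 : N ^ 2 = P * Q := by
    rw [hN, Real.sq_sqrt (by positivity), hP, hQ]; ring
  have hN0 : N ≠ 0 := by
    intro h0
    rw [h0] at hN2
    have := mul_pos hPpos hQpos
    nlinarith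
  have hsin0 : Real.sin θ ≠ 0 := by
    rw [hsin]
    exact div_ne_zero (by simpa using hk1') hN0
  have hcot : Real.cot θ ^ 2 + 1 = N ^ 2 / (4 * k1 ^ 2) := by
    have h1 : Real.cot θ ^ 2 + 1 = 1 / Real.sin θ ^ 2 := by
      rw [Real.cot_eq_cos_div_sin]
      have := Real.sin_sq_add_cos_sq θ
      field_simp
      linarith
    rw [h1, hsin]
    field_simp
    norm_num
  have hPQ : 4 * k1 * k2 = P - Q := by rw [hP, hQ]; ring
  have hCx : C = (P - Q) * (P - x ^ 2 * Q) / (x ^ 2 * (P * Q)) := by rw [hC, hPQ, hN2]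
  have ep : ((Real.cot θ ^ 2 + 1) * (tp ^ 2 + C)) ^ ((3 : ℝ) / 2)
      = ((P + x * Q) / (-(2 * k1) * x)) ^ 3 := by
    apply aux_rpow
    · apply div_nonneg (by positivity)
      apply mul_nonneg _ hx0.le
      linarith
    · rw [hcot, hN2, hCx, htp]
      field_simp
      ring
  have em : ((Real.cot θ ^ 2 + 1) * (tm ^ 2 + C)) ^ ((3 : ℝ) / 2)
      = ((P - x * Q) / (-(2 * k1) * x)) ^ 3 := by
    apply aux_rpow
    · apply div_nonneg (by linarith)
      apply mul_nonneg _ hx0.le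
      linarith
    · rw [hcot, hN2, hCx, htm]
      field_simp
      ring
  rw [hψ] at hbc0 hbc1
  simp only [] at hbc0 hbc1
  rw [em] at hbc0
  rw [ep] at hbc1
  obtain ⟨E, hE⟩ : ∃ E, E = sS * x ^ 2 - 3 * beta0 * (x + 1) + x + 3 := ⟨_, rfl⟩
  obtain ⟨g, hg⟩ : ∃ g, g = E / (2 * k2 ^ 2 * x * Q) := ⟨_, rfl⟩
  have hag : alpha = N * g := by rw [halpha, hg, hE, hQ]; ring
  have c1 : alpha * Real.cos θ / (3 * Real.sin θ ^ 2) - (shat - alpha * rhat) / 6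
      = g * (1 - k1 ^ 2 + k2 ^ 2) * (P * Q) / (12 * k1 ^ 2)
        - (2 * x * sS + 2 - g * (P * Q)) / 6 := by
    rw [hag, hcos, hsin, hshat, hrhat, ← hN2]
    field_simp
    ring
  have c2 : alpha / 3 * Real.sin θ = -(2 * k1) * g / 3 := by
    rw [hag, hsin]
    field_simp
  rw [c1, c2, htm] at hbc0
  rw [c1, c2, htp] at hbc1
  have key : d1 * (4 * k1 * k2 * x ^ 3) = -(1 + x) *
      ((1 + k1 ^ 2 + k2 ^ 2) * (x - 1) * E
        - 2 * k1 * k2 * (-3 * beta0 + sS * x ^ 3 - x ^ 2 * (beta0 + sS - 1) + 3)) := by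
    have hd : d1 = -(sS * ((1 + x) / x) ^ 2 - sS * ((1 - x) / x) ^ 2
        + (g * (1 - k1 ^ 2 + k2 ^ 2) * (P * Q) / (12 * k1 ^ 2)
          - (2 * x * sS + 2 - g * (P * Q)) / 6) * (((1 + x) / x) ^ 3 - ((1 - x) / x) ^ 3)
        - -(2 * k1) * g / 3 * (((P + x * Q) / (-(2 * k1) * x)) ^ 3
          - ((P - x * Q) / (-(2 * k1) * x)) ^ 3)) / 2 := by
      have h2 : d1 * ((1 + x) / x) - d1 * ((1 - x) / x) = 2 * d1 := by
        field_simp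
        ring
      linarith
    have hQ0 := hQpos.ne'
    rw [hd, hg]
    field_simp
    rw [hE, hP, hQ]
    ring
  rw [← hE]
  constructor
  · intro h0
    rw [h0, zero_mul] at key
    have h1 : -(1 + x) ≠ 0 := by linarith
    have := (mul_eq_zero.mp key.symm).resolve_left h1
    linarith
  · intro h0
    rw [h0, sub_self, mul_zero] at key
    exact (mul_eq_zero.mp key).resolve_right (by positivity)
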